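/- Let ℒ be the Laplacian tensor of a weighted k-uniform hypergraph on Fin n, and let C₁,…,C_p be a partition of Fin n into nonempty pairwise-disjoint sets with union Fin n. For each j define the indicator vector f_j : Fin n → ℝ by f_j i = 1/√(card C_j) if i ∈ C_j and f_j i = 0 otherwise. Then each f_j satisfies f_jᵀ f_j = 1 and Σ_{j=1}^{p} ℒ f_j^k = Σ_{j=1}^{p} (1/(card C_j)^{k/2}) · Σ_{e ∈ ∂E} card(C_j ∩ e) · w e, i.e., the sum of the Laplacian forms of the indicator vectors equals k times the Ratio-Cut of the partition. -/

import Mathlib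

open Finset

/-- Degree of vertex `i` in a weighted hypergraph `(E, w)`. -/
noncomputable def deg {n : ℕ} (E : Finset (Finset (Fin n))) (w : Finset (Fin n) → ℝ)
    (i : Fin n) : ℝ :=
  ∑ e ∈ E.filter (fun e => i ∈ e), w e

/-- Adjacency tensor of a weighted `k`-uniform hypergraph. -/
noncomputable def adjT {n : ℕ} (E : Finset (Finset (Fin n))) (w : Finset (Fin n) → ℝ)
    (k : ℕ) (σ : Fin k → Fin n) : ℝ :=
  if Function.Injective σ ∧ Finset.image σ Finset.univ ∈ E then
    w (Finset.image σ Finset.univ) / (Nat.factorial (k - 1)) else 0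

/-- Laplacian tensor `𝒟 - 𝒜`. -/
noncomputable def lapT {n : ℕ} (E : Finset (Finset (Fin n))) (w : Finset (Fin n) → ℝ)
    (k : ℕ) (σ : Fin k → Fin n) : ℝ :=
  (∑ i : Fin n, if σ = Function.const (Fin k) i then deg E w i else 0) - adjT E w k σ

/-- The tuple `(i, τ₁, …, τ_{k-1})`. -/
def consT {n : ℕ} (k : ℕ) (i : Fin n) (τ : Fin (k - 1) → Fin n) : Fin k → Fin n :=
  fun t => if ht : t.val = 0 then i else τ ⟨t.val - 1, by have := t.isLt; omega⟩

/-- The Laplacian form `ℒ x^k`. -/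
noncomputable def lapForm {n : ℕ} (E : Finset (Finset (Fin n))) (w : Finset (Fin n) → ℝ)
    (k : ℕ) (x : Fin n → ℝ) : ℝ :=
  ∑ σ : Fin k → Fin n, lapT E w k σ * ∏ t, x (σ t)

/-- A set of size `k` has `k!` enumerations by `Fin k`. -/
lemma card_filter_injective_image_eq {α : Type*} [Fintype α] [DecidableEq α] {k : ℕ}
    (e : Finset α) (he : e.card = k) :
    (univ.filter fun σ : Fin k → α => Function.Injective σ ∧ univ.image σ = e).card =
      k.factorial := by
  have hcard : Fintype.card (Fin k ≃ e) = k.factorial := by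
    have := Fintype.card_equiv (finCongr he.symm |>.trans e.equivFin.symm)
    simpa using this
  rw [← hcard, ← Finset.card_univ]
  symm
  refine Finset.card_bij (fun g _ t => (g t : α)) ?_ ?_ ?_
  · intro g _
    simp only [mem_filter, mem_univ, true_and]
    refine ⟨fun a b h => g.injective (Subtype.ext h), ?_⟩
    ext a
    simp only [mem_image, mem_univ, true_and]
    exact ⟨fun ⟨t, ht⟩ => ht ▸ (g t).2, fun ha => ⟨g.symm ⟨a, ha⟩, by simp⟩⟩
  · intro g _ g' _ h
    ext t
    exact congrFun h t
  · intro σ hσ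
    simp only [mem_filter, mem_univ, true_and] at hσ
    obtain ⟨hinj, rfl⟩ := hσ
    refine ⟨Equiv.ofBijective (fun t => ⟨σ t, mem_image_of_mem σ (mem_univ t)⟩)
      ⟨fun a b h => hinj (congrArg Subtype.val h), ?_⟩, mem_univ _, rfl⟩
    rintro ⟨a, ha⟩
    obtain ⟨t, -, rfl⟩ := mem_image.mp ha
    exact ⟨t, rfl⟩

lemma sum_adjT_mul_prod {n k : ℕ} (hk : 1 ≤ k) (E : Finset (Finset (Fin n)))
    (w : Finset (Fin n) → ℝ) (hcard : ∀ e ∈ E, e.card = k) (x : Fin n → ℝ) :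
    ∑ σ : Fin k → Fin n, adjT E w k σ * ∏ t, x (σ t) =
      ∑ e ∈ E, w e * (k * ∏ i ∈ e, x i) := by
  have hσ : ∀ σ : Fin k → Fin n, adjT E w k σ * ∏ t, x (σ t) =
      ∑ e ∈ E, if Function.Injective σ ∧ univ.image σ = e then
        w e / (k - 1).factorial * ∏ i ∈ e, x i else 0 := by
    intro σ
    by_cases hinj : Function.Injective σ
    · have hprod : ∏ i ∈ univ.image σ, x i = ∏ t, x (σ t) :=
        Finset.prod_image fun a _ b _ h => hinj h
      simp only [adjT, hinj, true_and, Finset.sum_ite_eq, hprod]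
      split_ifs <;> simp
    · simp [adjT, hinj]
  simp_rw [hσ]
  rw [Finset.sum_comm]
  refine Finset.sum_congr rfl fun e he => ?_
  rw [← Finset.sum_filter, Finset.sum_const, card_filter_injective_image_eq e (hcard e he),
    nsmul_eq_mul, ← Nat.mul_factorial_pred (by omega : k ≠ 0)]
  have : ((k - 1).factorial : ℝ) ≠ 0 := by positivity
  push_cast
  field_simp

lemma lapForm_eq_sum_edges {n k : ℕ} (hk : 1 ≤ k) (E : Finset (Finset (Fin n)))
    (w : Finset (Fin n) → ℝ) (hcard : ∀ e ∈ E, e.card = k) (x : Fin n → ℝ) :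
    lapForm E w k x = ∑ e ∈ E, w e * (∑ i ∈ e, x i ^ k - k * ∏ i ∈ e, x i) := by
  have hdiag : ∑ σ : Fin k → Fin n,
      (∑ i, if σ = Function.const (Fin k) i then deg E w i else 0) * ∏ t, x (σ t) =
        ∑ e ∈ E, w e * ∑ i ∈ e, x i ^ k := by
    simp_rw [Finset.sum_mul, ite_mul, zero_mul]
    rw [Finset.sum_comm]
    simp only [Finset.sum_ite_eq', mem_univ, if_true, Function.const_apply,
      prod_const, card_univ, Fintype.card_fin, deg, Finset.sum_filter, Finset.sum_mul,
      Finset.mul_sum]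
    rw [Finset.sum_comm]
    refine Finset.sum_congr rfl fun e _ => ?_
    simp [ite_mul]
  simp only [lapForm, lapT, sub_mul, mul_sub, Finset.sum_sub_distrib, hdiag,
    sum_adjT_mul_prod hk E w hcard x]

lemma sum_pow_sub_prod_indicator {α : Type*} [DecidableEq α] {k : ℕ} (hk : k ≠ 0)
    (C e : Finset α) (he : e.card = k) (c : ℝ) :
    ∑ i ∈ e, (if i ∈ C then c else 0) ^ k - k * ∏ i ∈ e, (if i ∈ C then c else 0) =
      c ^ k * if e ⊆ C then 0 else ((C ∩ e).card : ℝ) := by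
  have hsum : ∑ i ∈ e, (if i ∈ C then c else 0) ^ k = (C ∩ e).card * c ^ k := by
    simp [ite_pow, hk, Finset.inter_comm]
  rw [hsum]
  split_ifs with h
  · rw [Finset.inter_eq_right.mpr h, Finset.prod_congr rfl fun i hi => if_pos (h hi),
      Finset.prod_const, he]
    ring
  · obtain ⟨i, hi, hiC⟩ := Finset.not_subset.mp h
    rw [Finset.prod_eq_zero hi (if_neg hiC)]
    ring

/-- the sum of Laplacian forms of the indicator vectors of a partition
equals `k` times the Ratio-Cut of the partition. -/
theorem sum_lapForm_indicators_eq_ratio_cut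
    (n k : ℕ) (hn : 1 ≤ n) (hk : 2 ≤ k)
    (E : Finset (Finset (Fin n))) (w : Finset (Fin n) → ℝ)
    (hcard : ∀ e ∈ E, e.card = k) (hw : ∀ e ∈ E, 0 < w e)
    (p : ℕ) (C : Fin p → Finset (Fin n))
    (hCne : ∀ j, (C j).Nonempty)
    (hdisj : ∀ j₁ j₂, j₁ ≠ j₂ → Disjoint (C j₁) (C j₂))
    (hcover : Finset.univ.biUnion C = (Finset.univ : Finset (Fin n)))
    (f : Fin p → Fin n → ℝ)
    (hf : ∀ j i, f j i = if i ∈ C j then 1 / Real.sqrt ((C j).card) else 0) :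
    (∀ j, ∑ i, f j i * f j i = 1) ∧
    ∑ j, lapForm E w k (f j) =
      ∑ j, (1 / ((C j).card : ℝ) ^ ((k : ℝ) / 2)) *
        ∑ e ∈ E.filter (fun e => ¬ ∃ j', e ⊆ C j'), ((C j ∩ e).card : ℝ) * w e := by
  have hpos : ∀ j, (0 : ℝ) < (C j).card := fun j => by exact_mod_cast (hCne j).card_pos
  refine ⟨fun j => ?_, Finset.sum_congr rfl fun j _ => ?_⟩
  · have hsq : (√((C j).card : ℝ))⁻¹ * (√((C j).card : ℝ))⁻¹ = ((C j).card : ℝ)⁻¹ := by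
      rw [← mul_inv, Real.mul_self_sqrt (hpos j).le]
    simp [hf, hsq, (hpos j).ne']
  · have hpow : (1 / √((C j).card : ℝ)) ^ k = 1 / ((C j).card : ℝ) ^ ((k : ℝ) / 2) := by
      rw [div_pow, one_pow, Real.sqrt_eq_rpow, ← Real.rpow_mul_natCast (hpos j).le]
      congr 2
      ring
    rw [lapForm_eq_sum_edges (by omega) E w hcard, Finset.sum_filter, Finset.mul_sum]
    refine Finset.sum_congr rfl fun e he => ?_
    simp only [hf]
    rw [sum_pow_sub_prod_indicator (by omega) (C j) e (hcard e he), hpow]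
    by_cases hej : e ⊆ C j
    · rw [if_pos hej, if_neg (not_not.mpr ⟨j, hej⟩)]
      ring
    rw [if_neg hej]
    split_ifs with hb
    · obtain ⟨j', hj'⟩ := hb
      have hne : j ≠ j' := fun h => hej (h ▸ hj')
      have hdis : C j ∩ e = ∅ :=
        Finset.disjoint_iff_inter_eq_empty.mp ((hdisj j j' hne).mono_right hj')
      simp [hdis]
    · ring
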